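/- A stitched 2-ichromatic ordered graph has a unique interval 2-coloring: there is exactly one partition of its vertex set into two independent sets each consisting of consecutive vertices. -/

import Mathlib

/-- A `t`-edge-coloring `c` of the complete graph on the ordered vertex set `Fin N`
contains a monochromatic ordered copy of the ordered graph `G` on `Fin M`. -/
def HasMonoCopy {M N t : ℕ} (G : SimpleGraph (Fin M)) (c : Fin N → Fin N → Fin t) : Prop :=
  ∃ k : Fin t, ∃ f : Fin M → Fin N, StrictMono f ∧
    ∀ u v : Fin M, u < v → G.Adj u v → c (f u) (f v) = k

/-- The `t`-color ordered Ramsey number of the ordered graph `G`: the least `N` such that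
every `t`-coloring of the edges of the complete graph on `Fin N` contains a monochromatic
ordered copy of `G`. -/
noncomputable def orderedRamsey {M : ℕ} (t : ℕ) (G : SimpleGraph (Fin M)) : ℕ :=
  sInf {N : ℕ | ∀ c : Fin N → Fin N → Fin t, HasMonoCopy G c}

/-- An interval coloring of an ordered graph with `k` parts, encoded as a monotone
surjection onto `Fin k` whose fibers (the parts, which are intervals of consecutive
vertices) are independent sets. -/
def IsIntervalColoring {N k : ℕ} (G : SimpleGraph (Fin N)) (p : Fin N → Fin k) : Prop :=
  Monotone p ∧ Function.Surjective p ∧ ∀ u v : Fin N, G.Adj u v → p u ≠ p v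

/-- The interval chromatic number of an ordered graph. -/
noncomputable def intervalChromatic {N : ℕ} (G : SimpleGraph (Fin N)) : ℕ :=
  sInf {k : ℕ | ∃ p : Fin N → Fin k, IsIntervalColoring G p}

theorem agree_of_reachable {V : Type*} (G : SimpleGraph V) (p q : V → Fin 2)
    (hp : ∀ u v, G.Adj u v → p u ≠ p v) (hq : ∀ u v, G.Adj u v → q u ≠ q v)
    {u v : V} (h : G.Reachable u v) : p u = q u → p v = q v := by
  obtain ⟨w⟩ := h
  induction w with
  | nil => exact id
  | cons hadj _ ih =>
    intro h
    apply ih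
    have h1 := hp _ _ hadj
    have h2 := hq _ _ hadj
    omega

/-- A stitched 2-ichromatic ordered graph has a unique interval 2-coloring: there is
exactly one partition of its vertex set into two independent sets of consecutive
vertices (encoded as a monotone surjection onto `Fin 2` with independent fibers). -/
theorem stmt13 {m n : ℕ} (hm : 1 ≤ m) (hn : 1 ≤ n)
    (G : SimpleGraph (Fin (m + n)))
    (hichrom : intervalChromatic G = 2)
    (hpart1 : ∀ u v : Fin (m + n), (u : ℕ) < m → (v : ℕ) < m → ¬ G.Adj u v)
    (hpart2 : ∀ u v : Fin (m + n), m ≤ (u : ℕ) → m ≤ (v : ℕ) → ¬ G.Adj u v)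
    (hstitched : G.Reachable ⟨0, by omega⟩ ⟨m - 1, by omega⟩ ∧
      G.Reachable ⟨0, by omega⟩ ⟨m, by omega⟩ ∧
      G.Reachable ⟨0, by omega⟩ ⟨m + n - 1, by omega⟩) :
    ∃! p : Fin (m + n) → Fin 2, IsIntervalColoring G p := by
  have hq : IsIntervalColoring G (fun v : Fin (m + n) => if (v : ℕ) < m then (0 : Fin 2) else 1) := by
    refine ⟨?_, ?_, ?_⟩
    · intro a b hab
      have hab' : (a : ℕ) ≤ b := hab
      dsimp only
      split_ifs <;> first | omega | simp
    · intro y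
      have hy : y = 0 ∨ y = 1 := by omega
      rcases hy with rfl | rfl
      · exact ⟨⟨0, by omega⟩, if_pos (by simp; omega)⟩
      · exact ⟨⟨m, by omega⟩, if_neg (by simp)⟩
    · intro u v huv
      have h1 := hpart1 u v
      have h2 := hpart2 u v
      dsimp only
      split_ifs with a b b
      · exact absurd huv (h1 a b)
      · simp
      · simp
      · exact absurd huv (h2 (by omega) (by omega))
  refine ⟨_, hq, ?_⟩
  rintro p ⟨hmono, hsurj, hp⟩
  have h0 : p ⟨0, by omega⟩ = 0 := by
    obtain ⟨x, hx⟩ := hsurj 0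
    have : p ⟨0, by omega⟩ ≤ p x := hmono (Fin.mk_le_of_le_val (Nat.zero_le _))
    rw [hx] at this
    omega
  have key := fun v (hv : G.Reachable ⟨0, by omega⟩ v) => agree_of_reachable G p _ hp hq.2.2 (u := ⟨0, by omega⟩) (v := v) hv
    (by rw [h0]; exact (if_pos (by simp; omega)).symm)
  have k1 := key _ hstitched.1
  have k2 := key _ hstitched.2.1
  rw [if_pos (by simp; omega)] at k1
  rw [if_neg (by simp)] at k2
  funext v
  split_ifs with h
  · have : p v ≤ p ⟨m - 1, by omega⟩ := hmono (by rw [Fin.le_def]; simp; omega)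
    rw [k1] at this
    omega
  · have : p ⟨m, by omega⟩ ≤ p v := hmono (by rw [Fin.le_def]; simp; omega)
    rw [k2] at this
    omega
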